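/- arXiv:0912.0573 — 4 statements merged into one kernel-verified Lean document; each statement's English description precedes it below -/
import Mathlib

section
/- For integers 2 ≤ i ≤ j, the number of pairs of tuples ((u_i, u_{i+1}, …, u_j), (v_i, v_{i+1}, …, v_j)) of positive integers satisfying (i) 1 ≤ u_k ≤ k and 1 ≤ v_k ≤ k for all i ≤ k ≤ j, (ii) u_i > v_j, and (iii) u_i ≤ v_k for all i ≤ k ≤ j−1, is equal to (j−i)!² · C(j, i) · C(j, i−2), where C denotes the binomial coefficient. -/
theorem Nat.sum_range_sub_mul_choose (n d : ℕ) :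
    ∑ m ∈ Finset.range (n + 1), (n - m) * (m + d).choose d = (n + 1 + d).choose (d + 2) := by
  induction n with
  | zero => simp [Nat.choose_eq_zero_of_lt (show 1 + d < d + 2 by omega)]
  | succ n ih =>
    have h : ∀ m ∈ Finset.range (n + 1), (n + 1 - m) * (m + d).choose d =
        (n - m) * (m + d).choose d + (m + d).choose d := by
      intro m hm
      rw [Finset.mem_range] at hm
      rw [show n + 1 - m = n - m + 1 by omega, add_one_mul]
    rw [Finset.sum_range_succ, Finset.sum_congr rfl h, Finset.sum_add_distrib, ih,
      Nat.sum_range_add_choose, show n + 1 + 1 + d = n + 1 + d + 1 by ring,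
      Nat.choose_succ_succ' (n + 1 + d) (d + 1), show n + d + 1 = n + 1 + d by ring]
    rw [Nat.sub_self, zero_mul, add_zero, add_comm]

theorem Finset.prod_Icc_ite_eq_left (i d : ℕ) :
    ∏ k ∈ Finset.Icc i (i + d), (if k = i then 1 else k) =
      d.factorial * (i + d).choose d := by
  rw [← Nat.ascFactorial_eq_factorial_mul_choose, Nat.ascFactorial_eq_prod_range]
  induction d with
  | zero => simp
  | succ d ih =>
    rw [← add_assoc, Finset.prod_Icc_succ_top (by omega), ih, Finset.prod_range_succ,
      if_neg (by omega)]
    ring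

theorem Finset.prod_Icc_ite_eq_right {a i : ℕ} (ha : a ≤ i) (d : ℕ) :
    ∏ k ∈ Finset.Icc i (i + d), (if k = i + d then a - 1 else k + 1 - a) =
      (a - 1) * (d.factorial * (i - a + d).choose d) := by
  rw [← Nat.ascFactorial_eq_factorial_mul_choose, Nat.ascFactorial_eq_prod_range,
    ← Finset.Ico_insert_right (by omega), Finset.prod_insert (by simp), if_pos rfl,
    Finset.prod_Ico_eq_prod_range, Nat.add_sub_cancel_left]
  congr 1
  refine Finset.prod_congr rfl fun k hk => ?_
  rw [Finset.mem_range] at hk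
  rw [if_neg (by omega)]
  omega

/-- The elementary kernel factors of type `(i,j)` with `u_i = a`. -/
def kernelFactorFiber (i j a : ℕ) :
    Finset ((↥(Set.Icc i j) → ℕ) × (↥(Set.Icc i j) → ℕ)) :=
  Fintype.piFinset (fun k : ↥(Set.Icc i j) =>
      if (k : ℕ) = i then {a} else Finset.Icc 1 (k : ℕ)) ×ˢ
    Fintype.piFinset (fun k : ↥(Set.Icc i j) =>
      if (k : ℕ) = j then Finset.Icc 1 (a - 1) else Finset.Icc a (k : ℕ))

theorem card_kernelFactorFiber {a i : ℕ} (ha : a ≤ i) (d : ℕ) :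
    (kernelFactorFiber i (i + d) a).card =
      (d.factorial * (i + d).choose d) *
        ((a - 1) * (d.factorial * (i - a + d).choose d)) := by
  rw [kernelFactorFiber, Finset.card_product, Fintype.card_piFinset, Fintype.card_piFinset,
    ← Finset.prod_Icc_ite_eq_left, ← Finset.prod_Icc_ite_eq_right ha,
    Finset.prod_subtype (p := (· ∈ Set.Icc i (i + d)))
      (F := inferInstanceAs (Fintype ↥(Set.Icc i (i + d))))
      (Finset.Icc i (i + d)) (by simp),
    Finset.prod_subtype (p := (· ∈ Set.Icc i (i + d)))
      (F := inferInstanceAs (Fintype ↥(Set.Icc i (i + d))))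
      (Finset.Icc i (i + d)) (by simp)]
  simp only [apply_ite Finset.card, Finset.card_singleton, Nat.card_Icc, Nat.add_sub_cancel]

theorem mem_kernelFactorFiber {i j : ℕ} (hij : i ≤ j) {a : ℕ} (ha : a ∈ Finset.Icc 1 i)
    (p : (↥(Set.Icc i j) → ℕ) × (↥(Set.Icc i j) → ℕ)) :
    p ∈ kernelFactorFiber i j a ↔
      p.1 ⟨i, Set.mem_Icc.mpr ⟨le_rfl, hij⟩⟩ = a ∧
      (∀ k : ↥(Set.Icc i j),
          1 ≤ p.1 k ∧ p.1 k ≤ (k : ℕ) ∧ 1 ≤ p.2 k ∧ p.2 k ≤ (k : ℕ)) ∧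
      p.2 ⟨j, Set.mem_Icc.mpr ⟨hij, le_rfl⟩⟩ <
        p.1 ⟨i, Set.mem_Icc.mpr ⟨le_rfl, hij⟩⟩ ∧
      (∀ k : ↥(Set.Icc i j), (k : ℕ) < j →
          p.1 ⟨i, Set.mem_Icc.mpr ⟨le_rfl, hij⟩⟩ ≤ p.2 k) := by
  obtain ⟨u, v⟩ := p
  rw [Finset.mem_Icc] at ha
  simp only [kernelFactorFiber, Finset.mem_product, Fintype.mem_piFinset]
  constructor
  · rintro ⟨hu, hv⟩
    have hui := hu ⟨i, Set.mem_Icc.mpr ⟨le_rfl, hij⟩⟩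
    have hvj := hv ⟨j, Set.mem_Icc.mpr ⟨hij, le_rfl⟩⟩
    simp only [if_true, Finset.mem_singleton, Finset.mem_Icc] at hui hvj
    refine ⟨hui, fun k => ?_, by omega, fun k hk => ?_⟩
    · have huk := hu k
      have hvk := hv k
      have hk := Set.mem_Icc.mp k.2
      split_ifs at huk hvk <;> simp only [Finset.mem_singleton, Finset.mem_Icc] at huk hvk <;> omega
    · have hvk := hv k
      rw [if_neg hk.ne, Finset.mem_Icc] at hvk
      omega
  · rintro ⟨hui, h, hvj, hv⟩
    refine ⟨fun k => ?_, fun k => ?_⟩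
    · split_ifs with hk
      · rw [Finset.mem_singleton, ← hui]
        exact congrArg u (Subtype.ext hk)
      · exact Finset.mem_Icc.mpr ⟨(h k).1, (h k).2.1⟩
    · have hk := h k
      split_ifs with hkj
      · obtain rfl : k = ⟨j, Set.mem_Icc.mpr ⟨hij, le_rfl⟩⟩ := Subtype.ext hkj
        rw [Finset.mem_Icc]
        omega
      · have hvk := hv k (lt_of_le_of_ne k.2.2 hkj)
        rw [Finset.mem_Icc]
        omega

/-- The number of elementary kernel factors of type `(i,j)` of the original
Bernoulli game: pairs of tuples `(u_i,…,u_j)`, `(v_i,…,v_j)` with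
`1 ≤ u_k, v_k ≤ k`, `u_i > v_j`, and `u_i ≤ v_k` for `i ≤ k ≤ j-1`. -/
theorem card_elementary_kernel_factors (i j : ℕ) (h2 : 2 ≤ i) (hij : i ≤ j) :
    Nat.card {p : (↥(Set.Icc i j) → ℕ) × (↥(Set.Icc i j) → ℕ) //
      (∀ k : ↥(Set.Icc i j),
          1 ≤ p.1 k ∧ p.1 k ≤ (k : ℕ) ∧ 1 ≤ p.2 k ∧ p.2 k ≤ (k : ℕ)) ∧
      p.2 ⟨j, Set.mem_Icc.mpr ⟨hij, le_rfl⟩⟩ <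
        p.1 ⟨i, Set.mem_Icc.mpr ⟨le_rfl, hij⟩⟩ ∧
      (∀ k : ↥(Set.Icc i j), (k : ℕ) < j →
          p.1 ⟨i, Set.mem_Icc.mpr ⟨le_rfl, hij⟩⟩ ≤ p.2 k)} =
    Nat.factorial (j - i) ^ 2 * j.choose i * j.choose (i - 2) := by
  obtain ⟨d, rfl⟩ := Nat.exists_eq_add_of_le hij
  rw [Nat.subtype_card ((Finset.Icc 1 i).biUnion (kernelFactorFiber i (i + d)))]
  · rw [Finset.card_biUnion]
    · obtain ⟨n, rfl⟩ : ∃ n, i = n + 1 := ⟨i - 1, by omega⟩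
      rw [Finset.sum_congr rfl fun a ha => card_kernelFactorFiber (Finset.mem_Icc.mp ha).2 d,
        ← Finset.mul_sum, Nat.add_sub_cancel_left, ← Nat.choose_symm_add,
        ← Nat.choose_symm_of_eq_add (show n + 1 + d = (d + 2) + (n + 1 - 2) by omega),
        ← Nat.sum_range_sub_mul_choose, ← Finset.sum_range_reflect,
        ← Finset.Ico_succ_right_eq_Icc, Finset.sum_Ico_eq_sum_range]
      simp only [Finset.mul_sum]
      refine Finset.sum_congr (by simp) fun m hm => ?_
      simp only [Finset.mem_range] at hm
      rw [show n + 1 - (1 + m) = n + 1 - 1 - m by omega, show n - (n + 1 - 1 - m) = m by omega,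
        show 1 + m - 1 = m by omega]
      ring
    · intro a ha b hb hab
      refine Finset.disjoint_left.mpr fun p hpa hpb => hab ?_
      rw [mem_kernelFactorFiber hij ha] at hpa
      rw [mem_kernelFactorFiber hij hb] at hpb
      exact hpa.1.symm.trans hpb.1
  · intro p
    rw [Finset.mem_biUnion]
    constructor
    · rintro ⟨a, ha, hp⟩
      exact ((mem_kernelFactorFiber hij ha p).mp hp).2
    · intro hp
      have hi := hp.1 ⟨i, Set.mem_Icc.mpr ⟨le_rfl, hij⟩⟩
      have ha := Finset.mem_Icc.mpr ⟨hi.1, hi.2.1⟩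
      exact ⟨_, ha, (mem_kernelFactorFiber hij ha p).mpr ⟨rfl, hp⟩⟩
end

section
/- Let π be a permutation of {1,…,n} with place-based non-inversion table v_1⋯v_n. Then π is connected if and only if for every m with 1 ≤ m < n there exists k ∈ {m+1, …, n} with v_k ≤ m (equivalently, there is no m with 1 ≤ m < n such that v_k ≥ m+1 for all k ∈ {m+1, …, n}). -/
/-- The place-based non-inversion table (PNT) of a permutation `π` of
`{1,…,n}` (zero-indexed): `v_j = 1 + #{i < j : π(i) < π(j)}`. -/
def pnt {n : ℕ} (π : Equiv.Perm (Fin n)) (j : Fin n) : ℕ :=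
  1 + (Finset.univ.filter fun i : Fin n => i < j ∧ π i < π j).card

/-- A permutation of `{1,…,n}` (zero-indexed) is connected (indecomposable)
if there is no `m` with `1 ≤ m < n` mapping the first `m` letters into
themselves. -/
def ConnectedPerm {n : ℕ} (π : Equiv.Perm (Fin n)) : Prop :=
  ¬ ∃ m, 1 ≤ m ∧ m < n ∧ ∀ i : Fin n, (i : ℕ) < m → (π i : ℕ) < m

/-- If `π` maps the positions below `a` to values below `a`, then it maps every other
position to a value at least `a`. -/
theorem Equiv.Perm.le_apply_of_forall_lt {n : ℕ} {π : Equiv.Perm (Fin n)} {a : Fin n}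
    (h : ∀ i < a, π i < a) {k : Fin n} (hk : a ≤ k) : a ≤ π k := by
  by_contra! hlt
  have hsub : (insert k (Finset.Iio a)).map π.toEmbedding ⊆ Finset.Iio a := by
    intro x hx
    simp only [Finset.mem_map, Finset.mem_insert, Finset.mem_Iio, Equiv.coe_toEmbedding] at hx ⊢
    obtain ⟨i, rfl | hi, rfl⟩ := hx
    exacts [hlt, h i hi]
  have hcard := Finset.card_le_card hsub
  rw [Finset.card_map, Finset.card_insert_of_notMem (by simpa using hk)] at hcard
  omega

/-- If every value at a position below `a` is smaller than every value at the other
positions, then `π` maps the positions below `a` to values below `a`. -/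
theorem Equiv.Perm.apply_lt_of_forall_lt {n : ℕ} {π : Equiv.Perm (Fin n)} {a : Fin n}
    (h : ∀ i < a, ∀ j, a ≤ j → π i < π j) {i : Fin n} (hi : i < a) : π i < a := by
  have hsub : (Finset.Iic (π i)).map π.symm.toEmbedding ⊆ Finset.Iio a := by
    intro x hx
    simp only [Finset.mem_map, Finset.mem_Iic, Finset.mem_Iio, Equiv.coe_toEmbedding] at hx ⊢
    obtain ⟨v, hv, rfl⟩ := hx
    by_contra! hle
    have := h i hi _ hle
    rw [Equiv.apply_symm_apply] at this
    exact absurd hv this.not_ge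
  have hcard := Finset.card_le_card hsub
  rw [Finset.card_map, Fin.card_Iic, Fin.card_Iio] at hcard
  exact Fin.lt_def.mpr hcard

/-- `π` maps the positions below `a` to values below `a` if and only if all later
entries of its PNT exceed `a`. -/
theorem forall_apply_lt_iff_forall_lt_pnt {n : ℕ} (π : Equiv.Perm (Fin n)) (a : Fin n) :
    (∀ i < a, π i < a) ↔ ∀ k, a ≤ k → (a : ℕ) < pnt π k := by
  constructor
  · intro h k hk
    have hsub : Finset.Iio a ⊆ Finset.univ.filter fun i : Fin n => i < k ∧ π i < π k := by
      intro i hi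
      rw [Finset.mem_Iio] at hi
      simpa using ⟨hi.trans_le hk, (h i hi).trans_le (Equiv.Perm.le_apply_of_forall_lt h hk)⟩
    have hcard := Finset.card_le_card hsub
    rw [Fin.card_Iio] at hcard
    unfold pnt
    omega
  · intro h i hi
    obtain ⟨k, hk, hmin⟩ := Finset.exists_min_image (Finset.Ici a) π ⟨a, by simp⟩
    simp only [Finset.mem_Ici] at hk hmin
    have hsub : (Finset.univ.filter fun i : Fin n => i < k ∧ π i < π k) ⊆ Finset.Iio a := by
      intro j hj
      simp only [Finset.mem_filter, Finset.mem_univ, true_and, Finset.mem_Iio] at hj ⊢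
      by_contra! hle
      exact absurd (hmin j hle) hj.2.not_ge
    have heq := Finset.eq_of_subset_of_card_le hsub (by
      have := h k hk
      unfold pnt at this
      rw [Fin.card_Iio]
      omega)
    refine Equiv.Perm.apply_lt_of_forall_lt (fun i hi j hj => ?_) hi
    have hmem := Finset.mem_Iio.mpr hi
    rw [← heq, Finset.mem_filter] at hmem
    exact hmem.2.2.trans_le (hmin j hj)

theorem connected_iff_pnt (n : ℕ) (π : Equiv.Perm (Fin n)) :
    ConnectedPerm π ↔
      ∀ m, 1 ≤ m → m < n → ∃ k : Fin n, m ≤ (k : ℕ) ∧ pnt π k ≤ m := by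
  unfold ConnectedPerm
  push Not
  refine forall_congr' fun m => forall_congr' fun _ => forall_congr' fun hm => ?_
  have key := not_congr (forall_apply_lt_iff_forall_lt_pnt π ⟨m, hm⟩)
  push Not at key
  exact key
end

section
/- Let n ≥ 2 and let σ be a permutation of {1,…,n} with σ(1) = 1 and σ(n) = n, and let 1 = i_0 < i_1 < ⋯ < i_{k+1} = n be the complete list of strong fixed points of σ in increasing order. Then the number of connected permutations π of {1,…,n} whose elevation satisfies E(π) = σ is exactly (i_1 + 1)(i_2 + 1)⋯(i_k + 1). -/
open Classical

/-- `σ` is the elevation `E(π)` of the connected permutation `π`: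
for some (necessarily unique) decomposition `1 = j₀ < j₁ < ⋯ < j_{l+1} = n`
(one-indexed) of the PNT `v` of `π` into elementary kernel factors
(`v_s ≥ j_t + 1` for `j_t + 1 ≤ s ≤ j_{t+1} - 1` and `v_{j_{t+1}} ≤ j_t`),
the PNT `u` of `σ` satisfies `u_{j_t} = j_t` for `t ∈ {1,…,l+1}` and
`u_s = v_s` for all other indices `s`. -/
def IsElevation {n : ℕ} (π σ : Equiv.Perm (Fin n)) : Prop :=
  ∃ l, ∃ c : Fin (l + 2) → ℕ,
    StrictMono c ∧ c 0 = 1 ∧ c (Fin.last (l + 1)) = n ∧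
    (∀ t : Fin (l + 1),
      (∀ s : Fin n, c t.castSucc + 1 ≤ (s : ℕ) + 1 → (s : ℕ) + 1 < c t.succ →
        c t.castSucc + 1 ≤ pnt π s) ∧
      (∀ s : Fin n, (s : ℕ) + 1 = c t.succ → pnt π s ≤ c t.castSucc)) ∧
    (∀ s : Fin n,
      pnt σ s = if ∃ t : Fin (l + 1), (s : ℕ) + 1 = c t.succ then (s : ℕ) + 1 else pnt π s)

/-- The PNT of `π` as a one-indexed function on `ℕ`, with value `0` outside `{1,…,n}`. -/
def pntExt {n : ℕ} (π : Equiv.Perm (Fin n)) (r : ℕ) : ℕ :=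
  if h : 1 ≤ r ∧ r ≤ n then pnt π ⟨r - 1, by omega⟩ else 0

/-- Scanning the word `v₁v₂⋯` from the left, `kernelEnd v s` is the last index `j_t ≤ s` at which
an elementary kernel factor ends. -/
def kernelEnd (v : ℕ → ℕ) : ℕ → ℕ
  | 0 => 1
  | s + 1 => if v (s + 1) ≤ kernelEnd v s then s + 1 else kernelEnd v s

/-- The word `v` read on the `q` positions after `s`, in a state where the last kernel factor ended
at `j`, has elevation `u` there and its last kernel factor ends at `s + q`. -/
def Elevates (u v : ℕ → ℕ) : ℕ → ℕ → ℕ → Prop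
  | 0, s, j => j = s
  | q + 1, s, j =>
    (1 ≤ v (s + 1) ∧ v (s + 1) ≤ j ∧ u (s + 1) = s + 1 ∧ Elevates u v q (s + 1) (s + 1)) ∨
      (j < v (s + 1) ∧ v (s + 1) = u (s + 1) ∧ Elevates u v q (s + 1) j)

/-- The words that agree with `u` outside `{s + 1,…,s + q}` and satisfy `Elevates u v q s j`. -/
noncomputable def preElevations (u : ℕ → ℕ) : ℕ → ℕ → ℕ → Finset (ℕ → ℕ)
  | 0, s, j => if j = s then {u} else ∅
  | q + 1, s, j =>
    (if u (s + 1) = s + 1 then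
      (Finset.Icc 1 j ×ˢ preElevations u q (s + 1) (s + 1)).image
        (fun p => Function.update p.2 (s + 1) p.1)
      else ∅) ∪
    (if j < u (s + 1) then preElevations u q (s + 1) j else ∅)

section Words

variable {u v : ℕ → ℕ}

lemma Elevates.congr {w : ℕ → ℕ} {q s j : ℕ} (h : ∀ r, s < r → v r = w r) :
    Elevates u v q s j ↔ Elevates u w q s j := by
  induction q generalizing s j with
  | zero => rfl
  | succ q ih =>
    simp only [Elevates]
    rw [h (s + 1) (by omega), ih fun r hr => h r (by omega), ih fun r hr => h r (by omega)]

lemma mem_preElevations {q s j : ℕ} :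
    v ∈ preElevations u q s j ↔ (∀ r, r ≤ s ∨ s + q < r → v r = u r) ∧ Elevates u v q s j := by
  induction q generalizing v s j with
  | zero =>
    simp only [preElevations, Elevates]
    split_ifs with h
    · simp only [Finset.mem_singleton, h, and_true]
      constructor
      · rintro rfl _ _; rfl
      · intro h; funext r; exact h r (by omega)
    · simp [h]
  | succ q ih =>
    simp only [preElevations, Finset.mem_union]
    constructor
    · rintro (hv | hv)
      · split_ifs at hv with hu
        · simp only [Finset.mem_image, Finset.mem_product, Finset.mem_Icc, Prod.exists] at hv
          obtain ⟨b, w, ⟨hb, hw⟩, rfl⟩ := hv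
          obtain ⟨hw1, hw2⟩ := ih.1 hw
          refine ⟨fun r hr => ?_, Or.inl ⟨by simpa using hb.1, by simpa using hb.2, hu, ?_⟩⟩
          · rw [Function.update_of_ne (by omega)]
            exact hw1 r (by omega)
          · refine (Elevates.congr fun r hr => ?_).1 hw2
            rw [Function.update_of_ne (by omega)]
        · simp at hv
      · split_ifs at hv with hu
        · obtain ⟨hw1, hw2⟩ := ih.1 hv
          have := hw1 (s + 1) (by omega)
          exact ⟨fun r hr => hw1 r (by omega), Or.inr ⟨by omega, this, hw2⟩⟩
        · simp at hv
    · rintro ⟨h1, ⟨h2, h3, h4, h5⟩ | ⟨h2, h3, h4⟩⟩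
      · left
        rw [if_pos h4]
        simp only [Finset.mem_image, Finset.mem_product, Finset.mem_Icc, Prod.exists]
        refine ⟨v (s + 1), Function.update v (s + 1) (u (s + 1)), ⟨⟨h2, h3⟩, ih.2 ⟨?_, ?_⟩⟩, ?_⟩
        · intro r hr
          by_cases hrs : r = s + 1
          · subst hrs; simp
          · rw [Function.update_of_ne hrs]
            exact h1 r (by omega)
        · refine (Elevates.congr fun r hr => ?_).1 h5
          rw [Function.update_of_ne (by omega)]
        · simp
      · right
        rw [if_pos (by omega)]
        refine ih.2 ⟨fun r hr => ?_, h4⟩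
        by_cases hrs : r = s + 1
        · rw [hrs, h3]
        · exact h1 r (by omega)

lemma card_preElevations_succ (q s j : ℕ) :
    (preElevations u (q + 1) s j).card =
      (if u (s + 1) = s + 1 then j * (preElevations u q (s + 1) (s + 1)).card else 0) +
      (if j < u (s + 1) then (preElevations u q (s + 1) j).card else 0) := by
  rw [preElevations, Finset.card_union_of_disjoint]
  · congr 1
    · split_ifs
      · rw [Finset.card_image_of_injOn]
        · simp
        · rintro ⟨a, v⟩ hv ⟨b, w⟩ hw h
          simp only [Finset.coe_product, Set.mem_prod, Finset.mem_coe] at hv hw h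
          have hv' := (mem_preElevations.1 hv.2).1
          have hw' := (mem_preElevations.1 hw.2).1
          have hr := fun r => congrFun h r
          have hab : a = b := by simpa using hr (s + 1)
          refine Prod.ext hab ?_
          funext r
          by_cases hrs : r = s + 1
          · change v r = w r
            rw [hv' r (by omega), hw' r (by omega)]
          · simpa [Function.update_of_ne hrs] using hr r
      · rfl
    · split_ifs <;> rfl
  · rw [Finset.disjoint_left]
    intro v hv hv'
    split_ifs at hv hv' with h1 h2 <;> try simp at hv hv'
    obtain ⟨b, w, ⟨hb, hw⟩, rfl⟩ := hv
    have := (mem_preElevations.1 hv').1 (s + 1) (by omega)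
    simp at this
    omega

/-- The index `m` is a strong fixed point of the permutation of `{1,…,n}` with PNT `u`. -/
def StrongIndex (u : ℕ → ℕ) (n m : ℕ) : Prop :=
  u m = m ∧ ∀ r, m < r → r ≤ n → m < u r

lemma card_preElevations {n q s j : ℕ} (hun : u n = n) (hj : j ≤ s) (hs : s + (q + 1) = n) :
    (preElevations u (q + 1) s j).card =
      if ∀ r, s < r → r ≤ n → j < u r then
        j * ∏ m ∈ (Finset.Ioo s n).filter (StrongIndex u n), (m + 1) else 0 := by
  induction q generalizing s j with
  | zero =>
    obtain rfl : s + 1 = n := by omega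
    have hall : ∀ r, s < r → r ≤ s + 1 → j < u r := by
      intro r h1 h2
      obtain rfl : r = s + 1 := by omega
      omega
    have he : Finset.Ioo s (s + 1) = ∅ := by ext; simp
    rw [card_preElevations_succ, if_pos hun, if_pos (by omega), if_pos hall, he]
    simp [preElevations]
    omega
  | succ q ih =>
    rw [card_preElevations_succ, ih le_rfl (by omega), ih (by omega) (by omega)]
    have hins : Finset.Ioo s n = insert (s + 1) (Finset.Ioo (s + 1) n) := by
      ext; simp; omega
    have hnm : s + 1 ∉ (Finset.Ioo (s + 1) n).filter (StrongIndex u n) := by simp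
    rw [hins, Finset.filter_insert]
    by_cases hst : StrongIndex u n (s + 1)
    · have hall : ∀ r, s < r → r ≤ n → j < u r := by
        intro r h1 h2
        rcases Nat.lt_or_ge (s + 1) r with h | h
        · have := hst.2 r h h2
          omega
        · obtain rfl : r = s + 1 := by omega
          have := hst.1
          omega
      have h1 := hst.1
      rw [if_pos hst.1, if_pos hst.2, if_pos (by omega),
        if_pos (fun r hr => hall r (by omega)), if_pos hall, if_pos hst, Finset.prod_insert hnm]
      ring
    · have h0 : (if u (s + 1) = s + 1 then j * (if ∀ r, s + 1 < r → r ≤ n → s + 1 < u r then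
          (s + 1) * ∏ m ∈ (Finset.Ioo (s + 1) n).filter (StrongIndex u n), (m + 1) else 0)
          else 0) = 0 := by
        split_ifs with h1 h2
        · exact absurd ⟨h1, h2⟩ hst
        · rfl
        · rfl
      rw [h0, zero_add, if_neg hst]
      by_cases hall : ∀ r, s < r → r ≤ n → j < u r
      · rw [if_pos (hall _ (by omega) (by omega)), if_pos (fun r hr => hall r (by omega)),
          if_pos hall]
      · rw [if_neg hall]
        split_ifs with h1 h2
        · refine absurd (fun r hr hrn => ?_) hall
          rcases Nat.lt_or_ge (s + 1) r with h | h
          · exact h2 r h hrn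
          · obtain rfl : r = s + 1 := by omega
            exact h1
        · rfl
        · rfl

lemma kernelEnd_pos (s : ℕ) : 1 ≤ kernelEnd v s := by
  induction s with
  | zero => rfl
  | succ s ih => rw [kernelEnd]; split_ifs <;> omega

lemma kernelEnd_one : kernelEnd v 1 = 1 := by
  simp [kernelEnd]

lemma kernelEnd_le {s : ℕ} (hs : 1 ≤ s) : kernelEnd v s ≤ s := by
  induction s, hs using Nat.le_induction with
  | base => rw [kernelEnd_one]
  | succ s hs ih => rw [kernelEnd]; split_ifs <;> omega

lemma kernelEnd_succ_eq_self_iff {s : ℕ} (hs : 1 ≤ s) :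
    kernelEnd v (s + 1) = s + 1 ↔ v (s + 1) ≤ kernelEnd v s := by
  have := kernelEnd_le (v := v) hs
  rw [kernelEnd]; split_ifs <;> omega

lemma kernelEnd_succ_of_ne {s : ℕ} (h : kernelEnd v (s + 1) ≠ s + 1) :
    kernelEnd v (s + 1) = kernelEnd v s ∧ kernelEnd v s < v (s + 1) := by
  rw [kernelEnd] at h ⊢
  split_ifs at h ⊢ <;> omega

lemma elevates_kernelEnd_iff {q s : ℕ} (hv : ∀ r, s < r → r ≤ s + q → 1 ≤ v r) :
    Elevates u v q s (kernelEnd v s) ↔ kernelEnd v (s + q) = s + q ∧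
      ∀ r, s ≤ r → r < s + q →
        u (r + 1) = if v (r + 1) ≤ kernelEnd v r then r + 1 else v (r + 1) := by
  induction q generalizing s with
  | zero =>
    simp only [Elevates, add_zero]
    exact ⟨fun h => ⟨h, by omega⟩, fun h => h.1⟩
  | succ q ih =>
    have ih' := ih (s := s + 1) fun r h1 h2 => hv r (by omega) (by omega)
    have hv1 := hv (s + 1) (by omega) (by omega)
    rw [show s + (q + 1) = s + 1 + q by ring]
    have hsplit : (∀ r, s ≤ r → r < s + 1 + q →
        u (r + 1) = if v (r + 1) ≤ kernelEnd v r then r + 1 else v (r + 1)) ↔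
        (u (s + 1) = if v (s + 1) ≤ kernelEnd v s then s + 1 else v (s + 1)) ∧
        ∀ r, s + 1 ≤ r → r < s + 1 + q →
          u (r + 1) = if v (r + 1) ≤ kernelEnd v r then r + 1 else v (r + 1) := by
      constructor
      · exact fun h => ⟨h s le_rfl (by omega), fun r hr => h r (by omega)⟩
      · rintro ⟨h1, h2⟩ r hr hr'
        rcases hr.eq_or_lt with rfl | h
        · exact h1
        · exact h2 r h hr'
    rw [hsplit, and_left_comm, ← ih']
    simp only [Elevates]
    by_cases h : v (s + 1) ≤ kernelEnd v s
    · have : kernelEnd v (s + 1) = s + 1 := by rw [kernelEnd, if_pos h]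
      rw [this, if_pos h]
      simp [h, hv1, Nat.not_lt.2 h]
    · have : kernelEnd v (s + 1) = kernelEnd v s := by rw [kernelEnd, if_neg h]
      rw [this, if_neg h, eq_comm (a := u (s + 1)) (b := v (s + 1))]
      simp only [h, Nat.lt_of_not_le h, true_and, false_and, and_false, false_or]

lemma Elevates.bounds {q s j : ℕ} (hu : ∀ r, s < r → r ≤ s + q → 1 ≤ u r ∧ u r ≤ r)
    (hj : j ≤ s) (h : Elevates u v q s j) : ∀ r, s < r → r ≤ s + q → 1 ≤ v r ∧ v r ≤ r := by
  induction q generalizing s j with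
  | zero => intro r h1 h2; omega
  | succ q ih =>
    intro r h1 h2
    have hu1 := hu (s + 1) (by omega) (by omega)
    have hu' : ∀ r, s + 1 < r → r ≤ s + 1 + q → 1 ≤ u r ∧ u r ≤ r :=
      fun r h1 h2 => hu r (by omega) (by omega)
    obtain ⟨a, b, c, e⟩ | ⟨a, b, e⟩ := h
    · rcases Nat.lt_or_ge (s + 1) r with h | h
      · exact ih hu' le_rfl e r h (by omega)
      · obtain rfl : r = s + 1 := by omega
        omega
    · rcases Nat.lt_or_ge (s + 1) r with h | h
      · exact ih hu' (by omega) e r h (by omega)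
      · obtain rfl : r = s + 1 := by omega
        omega

end Words

section PNT

variable {n : ℕ}

lemma pnt_pos (π : Equiv.Perm (Fin n)) (j : Fin n) : 1 ≤ pnt π j := by
  unfold pnt; omega

lemma pnt_le (π : Equiv.Perm (Fin n)) (j : Fin n) : pnt π j ≤ j + 1 := by
  have : (Finset.univ.filter fun i : Fin n => i < j ∧ π i < π j).card ≤ (Finset.Iio j).card :=
    Finset.card_le_card fun i hi => by simp at hi ⊢; exact hi.1
  rw [Fin.card_Iio] at this
  unfold pnt; omega

lemma card_apply_lt (π : Equiv.Perm (Fin n)) (j : Fin n) :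
    (Finset.univ.filter fun i : Fin n => π i < π j).card = π j := by
  rw [← Fin.card_Iio (π j)]
  exact Finset.card_bij (fun i _ => π i) (by simp) (by simp)
    fun b hb => ⟨π.symm b, by simpa using hb, by simp⟩

lemma lt_iff_lt_of_pnt_eq {π τ : Equiv.Perm (Fin n)} (h : ∀ j, pnt π j = pnt τ j) (m : ℕ) :
    ∀ i j : Fin n, (i : ℕ) < m → (j : ℕ) < m → (π i < π j ↔ τ i < τ j) := by
  induction m with
  | zero => intro i j hi; omega
  | succ m ih =>
    have key : ∀ i j : Fin n, (j : ℕ) = m → i < j → (π i < π j ↔ τ i < τ j) := by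
      intro i j hj hij
      set A := Finset.univ.filter fun i : Fin n => i < j ∧ π i < π j with hA
      set B := Finset.univ.filter fun i : Fin n => i < j ∧ τ i < τ j with hB
      have hcard : A.card = B.card := by
        simpa [pnt] using h j
      have hAB : A = B := by
        by_cases hs : A ⊆ B
        · exact Finset.eq_of_subset_of_card_le hs hcard.ge
        · obtain ⟨a, haA, haB⟩ := Finset.not_subset.1 hs
          refine (Finset.eq_of_subset_of_card_le (fun b hb => ?_) hcard.le).symm
          simp only [hA, hB, Finset.mem_filter, Finset.mem_univ, true_and, not_and,
            not_lt] at haA haB hb ⊢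
          refine ⟨hb.1, lt_trans ?_ haA.2⟩
          refine (ih b a (by omega) (by omega)).2 (lt_of_lt_of_le hb.2 (haB haA.1))
      have := Finset.ext_iff.1 hAB i
      simpa [hA, hB, hij] using this
    have flip : ∀ i j : Fin n, i ≠ j → (π j < π i ↔ τ j < τ i) → (π i < π j ↔ τ i < τ j) := by
      intro i j hij hji
      have h1 : π i ≠ π j := π.injective.ne hij
      have h2 : τ i ≠ τ j := τ.injective.ne hij
      rw [← not_le, ← not_le, h1.symm.le_iff_lt, h2.symm.le_iff_lt, hji]
    intro i j hi hj
    rcases lt_trichotomy i j with hij | rfl | hij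
    · by_cases hjm : (j : ℕ) = m
      · exact key i j hjm hij
      · exact ih i j (by omega) (by omega)
    · simp
    · by_cases him : (i : ℕ) = m
      · exact flip i j hij.ne' (key j i him hij)
      · exact ih i j (by omega) (by omega)

lemma pnt_injective : Function.Injective (pnt : Equiv.Perm (Fin n) → Fin n → ℕ) := by
  intro π τ h
  ext j
  rw [← card_apply_lt π j, ← card_apply_lt τ j]
  congr 2
  ext i
  exact lt_iff_lt_of_pnt_eq (congrFun h) n i j i.2 j.2

lemma exists_pnt_eq (w : Fin n → ℕ) (hw : ∀ j, 1 ≤ w j ∧ w j ≤ j + 1) :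
    ∃ π : Equiv.Perm (Fin n), pnt π = w := by
  let F : Equiv.Perm (Fin n) → (j : Fin n) → Fin (j + 1) :=
    fun π j => ⟨pnt π j - 1, by have := pnt_le π j; omega⟩
  have hF : Function.Bijective F := by
    rw [Fintype.bijective_iff_injective_and_card]
    constructor
    · intro π τ h
      refine pnt_injective (funext fun j => ?_)
      have h1 : pnt π j - 1 = pnt τ j - 1 := congrArg Fin.val (congrFun h j)
      have h2 := pnt_pos π j
      have h3 := pnt_pos τ j
      omega
    · rw [Fintype.card_perm, Fintype.card_fin, Fintype.card_pi]
      simp only [Fintype.card_fin]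
      rw [Fin.prod_univ_eq_prod_range (fun j => j + 1), Finset.prod_range_add_one_eq_factorial]
  obtain ⟨π, hπ⟩ := hF.2 fun j => ⟨w j - 1, by have := hw j; omega⟩
  refine ⟨π, funext fun j => ?_⟩
  have h1 : pnt π j - 1 = w j - 1 := congrArg Fin.val (congrFun hπ j)
  have h2 := pnt_pos π j
  have h3 := hw j
  omega

lemma pnt_eq_succ_iff (π : Equiv.Perm (Fin n)) (j : Fin n) :
    pnt π j = j + 1 ↔ ∀ i < j, π i < π j := by
  have hsub : (Finset.univ.filter fun i : Fin n => i < j ∧ π i < π j) ⊆ Finset.Iio j :=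
    fun i hi => by simp at hi ⊢; exact hi.1
  constructor
  · intro h i hi
    have : i ∈ Finset.univ.filter fun i : Fin n => i < j ∧ π i < π j := by
      rw [Finset.eq_of_subset_of_card_le hsub]
      · simpa using hi
      · rw [Fin.card_Iio]
        unfold pnt at h; omega
    simp at this
    exact this.2
  · intro h
    have : (Finset.univ.filter fun i : Fin n => i < j ∧ π i < π j) = Finset.Iio j :=
      hsub.antisymm fun i hi => by simp at hi ⊢; exact ⟨hi, h i hi⟩
    unfold pnt
    rw [this, Fin.card_Iio]; omega

lemma card_val_lt {m : ℕ} (hm : m ≤ n) :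
    (Finset.univ.filter fun i : Fin n => (i : ℕ) < m).card = m := by
  rw [Fin.card_filter_val_lt]
  omega

/-- A permutation stabilizes an initial segment iff it sends it below its complement. -/
lemma stable_iff_forall_lt (π : Equiv.Perm (Fin n)) {m : ℕ} (hm : m ≤ n) :
    (∀ i : Fin n, (i : ℕ) < m → (π i : ℕ) < m) ↔
      ∀ i j : Fin n, (i : ℕ) < m → m ≤ (j : ℕ) → π i < π j := by
  set A := Finset.univ.filter fun i : Fin n => (i : ℕ) < m with hA
  constructor
  · intro h i j hi hj
    have hmap : A.map π.toEmbedding = A := by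
      refine Finset.eq_of_subset_of_card_le (fun x hx => ?_) (by simp)
      simp only [hA, Finset.mem_map, Finset.mem_filter, Finset.mem_univ, true_and] at hx ⊢
      obtain ⟨y, hy, rfl⟩ := hx
      exact h y hy
    have hj' : π j ∉ A := by
      rw [← hmap]
      simp [hA]
      omega
    have := h i hi
    simp [hA] at hj'
    omega
  · intro h i hi
    have hsub : (Finset.univ.filter fun x : Fin n => π x < π i) ⊂ A := by
      refine ⟨fun x hx => ?_, fun hs => ?_⟩
      · simp only [hA, Finset.mem_filter, Finset.mem_univ, true_and] at hx ⊢
        by_contra hc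
        exact lt_asymm hx (h i x hi (by omega))
      · have := hs (show i ∈ A by simpa [hA] using hi)
        simp at this
    have := Finset.card_lt_card hsub
    rwa [card_apply_lt, card_val_lt hm] at this

lemma stable_iff_lt_pnt (π : Equiv.Perm (Fin n)) {m : ℕ} (hm : m ≤ n) :
    (∀ i : Fin n, (i : ℕ) < m → (π i : ℕ) < m) ↔ ∀ j : Fin n, m ≤ (j : ℕ) → m < pnt π j := by
  rw [stable_iff_forall_lt π hm]
  constructor
  · intro h j hj
    have : (Finset.univ.filter fun i : Fin n => (i : ℕ) < m).card ≤
        (Finset.univ.filter fun i : Fin n => i < j ∧ π i < π j).card :=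
      Finset.card_le_card fun i hi => by
        simp at hi ⊢
        exact ⟨by omega, h i j hi hj⟩
    rw [card_val_lt hm] at this
    unfold pnt; omega
  · intro h i j hi hj
    induction j using WellFoundedLT.induction generalizing i with
    | ind j ih =>
      by_contra hc
      have hji : π j < π i := lt_of_le_of_ne (not_lt.1 hc) (π.injective.ne (by omega))
      have hsub : (Finset.univ.filter fun x : Fin n => x < j ∧ π x < π j) ⊂
          Finset.univ.filter fun x : Fin n => (x : ℕ) < m := by
        refine ⟨fun x hx => ?_, fun hs => ?_⟩
        · simp only [Finset.mem_filter, Finset.mem_univ, true_and] at hx ⊢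
          by_contra hxm
          exact lt_asymm (hx.2.trans hji) (ih x hx.1 i hi (by omega))
        · have := hs (show i ∈ _ by simpa using hi)
          simp only [Finset.mem_filter, Finset.mem_univ, true_and] at this
          exact hc this.2
      have h1 := Finset.card_lt_card hsub
      rw [card_val_lt hm] at h1
      have h2 := h j hj
      unfold pnt at h2; omega

end PNT

section Elevation

variable {n : ℕ}

lemma pntExt_succ (π : Equiv.Perm (Fin n)) (s : Fin n) : pntExt π (s + 1) = pnt π s := by
  have : 1 ≤ (s : ℕ) + 1 ∧ (s : ℕ) + 1 ≤ n := by omega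
  simp [pntExt, this]

lemma pntExt_bounds (π : Equiv.Perm (Fin n)) {r : ℕ} (h1 : 1 ≤ r) (h2 : r ≤ n) :
    1 ≤ pntExt π r ∧ pntExt π r ≤ r := by
  obtain ⟨r, rfl⟩ := Nat.exists_eq_add_of_le' h1
  rw [pntExt_succ π ⟨r, h2⟩]
  exact ⟨pnt_pos _ _, pnt_le _ _⟩

lemma pntExt_of_not (π : Equiv.Perm (Fin n)) {r : ℕ} (h : ¬(1 ≤ r ∧ r ≤ n)) :
    pntExt π r = 0 := dif_neg h

lemma pntExt_injective : Function.Injective (pntExt : Equiv.Perm (Fin n) → ℕ → ℕ) := by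
  intro π τ h
  refine pnt_injective (funext fun j => ?_)
  rw [← pntExt_succ, h, pntExt_succ]

lemma strongIndex_pntExt_iff (σ : Equiv.Perm (Fin n)) {m : ℕ} (h1 : 1 ≤ m) (h2 : m ≤ n) :
    StrongIndex (pntExt σ) n m ↔
      ∀ i : Fin n, ((i : ℕ) + 1 = m → σ i = i) ∧ ((i : ℕ) < m → (σ i : ℕ) < m) := by
  obtain ⟨j, rfl⟩ := Nat.exists_eq_add_of_le' h1
  obtain ⟨j, rfl⟩ : ∃ i : Fin n, (i : ℕ) = j := ⟨⟨j, h2⟩, rfl⟩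
  have hstab : (∀ r, (j : ℕ) + 1 < r → r ≤ n → (j : ℕ) + 1 < pntExt σ r) ↔
      ∀ i : Fin n, (i : ℕ) < j + 1 → (σ i : ℕ) < j + 1 := by
    rw [stable_iff_lt_pnt σ h2]
    constructor
    · intro h i hi
      rw [← pntExt_succ]
      exact h _ (by omega) i.2
    · intro h r hr hrn
      obtain ⟨s, rfl⟩ := Nat.exists_eq_add_of_le' (show 1 ≤ r by omega)
      rw [pntExt_succ σ ⟨s, hrn⟩]
      exact h ⟨s, hrn⟩ (by simpa using Nat.le_of_lt_succ hr)
  rw [StrongIndex, hstab, pntExt_succ, pnt_eq_succ_iff]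
  constructor
  · rintro ⟨hmax, hst⟩ i
    refine ⟨fun hi => ?_, hst i⟩
    obtain rfl : i = j := by ext; omega
    have hsub : Finset.Iio i ⊆ Finset.univ.filter fun x : Fin n => σ x < σ i :=
      fun x hx => by simpa using hmax x (by simpa using hx)
    have := Finset.card_le_card hsub
    rw [Fin.card_Iio, card_apply_lt] at this
    have := hst i (by omega)
    ext; omega
  · intro h
    refine ⟨fun i hi => ?_, fun i => (h i).2⟩
    have hj : σ j = j := (h j).1 rfl
    have hne : σ i ≠ σ j := σ.injective.ne hi.ne
    have := (h i).2 (by omega)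
    rw [hj] at hne ⊢
    omega

lemma connectedPerm_of_kernelEnd {π : Equiv.Perm (Fin n)} (h : kernelEnd (pntExt π) n = n) :
    ConnectedPerm π := by
  rintro ⟨m, h1, hm, hst⟩
  rw [stable_iff_lt_pnt π hm.le] at hst
  have key : ∀ r, m ≤ r → r ≤ n → kernelEnd (pntExt π) r ≤ m := by
    intro r hr
    induction r, hr using Nat.le_induction with
    | base => exact fun _ => kernelEnd_le h1
    | succ r hr ih =>
      intro hrn
      have h2 := ih (by omega)
      have h3 := hst ⟨r, hrn⟩ hr
      rw [← pntExt_succ] at h3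
      dsimp only at h3
      rw [kernelEnd, if_neg (by omega)]
      exact h2
  have := key n hm.le le_rfl
  omega

lemma isElevation_iff_kernelEnd (hn : 2 ≤ n) (π σ : Equiv.Perm (Fin n)) :
    IsElevation π σ ↔ kernelEnd (pntExt π) n = n ∧ ∀ r, 1 ≤ r → r < n →
      pntExt σ (r + 1) =
        if pntExt π (r + 1) ≤ kernelEnd (pntExt π) r then r + 1 else pntExt π (r + 1) := by
  set v := pntExt π with hv
  set u := pntExt σ with hu
  constructor
  · rintro ⟨l, c, hc, hc0, hcl, hfac, helev⟩
    have hmono : ∀ t, 1 ≤ c t := fun t => hc0 ▸ hc.monotone (Fin.zero_le t)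
    have key : ∀ s, 1 ≤ s → s ≤ n → ∀ t, c t ≤ s → (∀ t', t < t' → s < c t') →
        kernelEnd v s = c t := by
      intro s hs
      induction s, hs using Nat.le_induction with
      | base =>
        intro _ t ht _
        have := hmono t
        rw [kernelEnd_one]; omega
      | succ s hs ih =>
        intro hsn t ht ht'
        have hvs : v (s + 1) = pnt π ⟨s, hsn⟩ := pntExt_succ π ⟨s, hsn⟩
        rcases ht.eq_or_lt with hts | hts
        · obtain rfl | ⟨t, rfl⟩ := t.eq_zero_or_eq_succ
          · omega
          · have hlt := hc t.castSucc_lt_succ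
            have h1 := ih (by omega) t.castSucc (by omega) fun t' h => by
              have := hc.monotone (Fin.castSucc_lt_iff_succ_le.1 h)
              omega
            have h2 := (hfac t).2 ⟨s, hsn⟩ hts.symm
            rw [kernelEnd, if_pos (by omega), hts]
        · have h1 := ih (by omega) t (by omega) fun t' h => by
            have := ht' t' h
            omega
          obtain ⟨t, rfl⟩ | rfl := t.eq_castSucc_or_eq_last
          · have h2 := ht' _ t.castSucc_lt_succ
            have h3 := (hfac t).1 ⟨s, hsn⟩ (by simpa using Nat.le_of_lt_succ hts) h2
            rw [kernelEnd, if_neg (by omega), h1]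
          · omega
    refine ⟨?_, fun r hr hrn => ?_⟩
    · rw [key n (by omega) le_rfl (Fin.last _) hcl.le fun t ht => absurd ht (Fin.le_last t).not_gt,
        hcl]
    · have hvr : v (r + 1) = pnt π ⟨r, hrn⟩ := pntExt_succ π ⟨r, hrn⟩
      have hur : u (r + 1) = pnt σ ⟨r, hrn⟩ := pntExt_succ σ ⟨r, hrn⟩
      obtain ⟨t, ht1, ht2⟩ : ∃ t : Fin (l + 1), c t.castSucc ≤ r ∧ r < c t.succ := by
        by_contra! hcon
        have : ∀ t, c t ≤ r := by
          intro t
          induction t using Fin.induction with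
          | zero => omega
          | succ t ih => exact hcon t ih
        have := this (Fin.last _)
        omega
      have hke := key r hr hrn.le t.castSucc ht1 fun t' h => by
        have := hc.monotone (Fin.castSucc_lt_iff_succ_le.1 h)
        omega
      rw [hke, hur, helev ⟨r, hrn⟩, hvr]
      dsimp only
      by_cases hrt : r + 1 = c t.succ
      · rw [if_pos ⟨t, hrt⟩, if_pos ((hfac t).2 ⟨r, hrn⟩ hrt)]
      · have h3 := (hfac t).1 ⟨r, hrn⟩ (by simpa using ht1) (by dsimp only; omega)
        rw [if_neg, if_neg (by omega)]
        rintro ⟨t', ht'⟩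
        rcases lt_trichotomy t t' with h | rfl | h
        · have := hc.monotone (Fin.succ_le_succ_iff.2 h.le)
          have := hc (Fin.succ_lt_succ_iff.2 h)
          omega
        · exact hrt ht'
        · have := hc.monotone (Fin.succ_le_castSucc_iff.2 h)
          omega
  · rintro ⟨hlast, helev⟩
    set S := (Finset.Icc 1 n).filter fun s => kernelEnd v s = s with hS
    have h1S : 1 ∈ S := by simp [hS, kernelEnd_one]; omega
    have hnS : n ∈ S := by simp [hS, hlast]; omega
    have hcard : 2 ≤ S.card := by
      have : ({1, n} : Finset ℕ) ⊆ S := by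
        intro x hx
        simp only [Finset.mem_insert, Finset.mem_singleton] at hx
        rcases hx with rfl | rfl <;> assumption
      have h := Finset.card_le_card this
      rwa [Finset.card_pair (by omega)] at h
    obtain ⟨l, hl⟩ := Nat.exists_eq_add_of_le' hcard
    set c := S.orderEmbOfFin hl with hcdef
    have hc : StrictMono c := c.strictMono
    have hcS : ∀ t, c t ∈ S := fun t => S.orderEmbOfFin_mem hl t
    have hex : ∀ x ∈ S, ∃ t, c t = x := by
      intro x hx
      have : x ∈ Set.range c := by rw [hcdef, Finset.range_orderEmbOfFin]; exact hx
      exact this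
    have hbd : ∀ t, 1 ≤ c t ∧ c t ≤ n ∧ kernelEnd v (c t) = c t := fun t => by
      have := hcS t
      simpa [hS, and_assoc] using this
    have hc0 : c 0 = 1 := by
      obtain ⟨t, ht⟩ := hex 1 h1S
      have h1 := hc.monotone (Fin.zero_le t)
      have h2 := hbd 0
      omega
    have hcl : c (Fin.last (l + 1)) = n := by
      obtain ⟨t, ht⟩ := hex n hnS
      have h1 := hc.monotone (Fin.le_last t)
      have h2 := hbd (Fin.last (l + 1))
      omega
    have hblock : ∀ t : Fin (l + 1), ∀ s, c t.castSucc ≤ s → s < c t.succ →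
        kernelEnd v s = c t.castSucc ∧ (c t.castSucc < s → c t.castSucc < v s) := by
      intro t s hs
      induction s, hs using Nat.le_induction with
      | base => exact fun _ => ⟨(hbd _).2.2, fun h => absurd h (lt_irrefl _)⟩
      | succ s hs ih =>
        intro hst
        have h1 := (ih (by omega)).1
        have hne : kernelEnd v (s + 1) ≠ s + 1 := by
          intro h
          have h2 := (hbd t.succ).2.1
          obtain ⟨t', ht'⟩ := hex (s + 1) (by simp [hS, h]; omega)
          have h3 : t.castSucc < t' := hc.lt_iff_lt.1 (by omega)
          have h4 : t' < t.succ := hc.lt_iff_lt.1 (by omega)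
          exact absurd (Fin.castSucc_lt_iff_succ_le.1 h3) h4.not_ge
        have h2 := kernelEnd_succ_of_ne hne
        rw [h1] at h2
        exact ⟨h2.1, fun _ => h2.2⟩
    refine ⟨l, c, hc, hc0, hcl, fun t => ⟨fun s hs1 hs2 => ?_, fun s hs => ?_⟩, fun s => ?_⟩
    · have := (hblock t (s + 1) (by omega) hs2).2 (by omega)
      rwa [hv, pntExt_succ] at this
    · have hlt := hc t.castSucc_lt_succ
      have h1 := (hblock t s (by omega) (by omega)).1
      have h2 := (hbd t.succ).2.2
      have h3 := (hbd t.castSucc).1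
      rw [← hs, kernelEnd_succ_eq_self_iff (by omega), hv, pntExt_succ, ← hv, h1] at h2
      exact h2
    · have hiff : (∃ t : Fin (l + 1), (s : ℕ) + 1 = c t.succ) ↔
          1 ≤ (s : ℕ) ∧ kernelEnd v (s + 1) = s + 1 := by
        constructor
        · rintro ⟨t, ht⟩
          have h1 := hc t.castSucc_lt_succ
          have h2 := (hbd t.castSucc).1
          have h3 := (hbd t.succ).2.2
          rw [← ht] at h3
          exact ⟨by omega, h3⟩
        · rintro ⟨h1, h2⟩
          obtain ⟨t, ht⟩ := hex (s + 1) (by simp [hS, h2])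
          obtain rfl | ⟨t, rfl⟩ := t.eq_zero_or_eq_succ
          · omega
          · exact ⟨t, ht.symm⟩
      rcases Nat.eq_zero_or_pos (s : ℕ) with hs | hs
      · rw [if_neg (by rw [hiff]; omega)]
        have h1 := pnt_pos π s
        have h2 := pnt_le π s
        have h3 := pnt_pos σ s
        have h4 := pnt_le σ s
        omega
      · have h := helev s hs s.2
        rw [hu, hv, pntExt_succ, pntExt_succ, ← hv] at h
        rw [h]
        refine if_congr ?_ rfl rfl
        rw [hiff, kernelEnd_succ_eq_self_iff hs, hv, pntExt_succ]
        exact (and_iff_right hs).symm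

lemma isElevation_iff_elevates (hn : 2 ≤ n) (π σ : Equiv.Perm (Fin n)) :
    IsElevation π σ ↔ Elevates (pntExt σ) (pntExt π) (n - 1) 1 1 := by
  have h := elevates_kernelEnd_iff (u := pntExt σ) (v := pntExt π) (q := n - 1) (s := 1)
    fun r h1 h2 => (pntExt_bounds π (by omega) (by omega)).1
  rw [kernelEnd_one, show 1 + (n - 1) = n by omega] at h
  rw [isElevation_iff_kernelEnd hn, h]

/-- The PNT identifies the fiber of the elevation map over `σ` with `preElevations`. -/
lemma card_fiber_eq_card_preElevations (hn : 2 ≤ n) (σ : Equiv.Perm (Fin n)) :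
    Nat.card {π : Equiv.Perm (Fin n) // ConnectedPerm π ∧ IsElevation π σ} =
      (preElevations (pntExt σ) (n - 1) 1 1).card := by
  have hone : ∀ π : Equiv.Perm (Fin n), pntExt π 1 = 1 := fun π => by
    have := pntExt_bounds π le_rfl (show 1 ≤ n by omega)
    omega
  have hmem : ∀ π : Equiv.Perm (Fin n), IsElevation π σ →
      pntExt π ∈ preElevations (pntExt σ) (n - 1) 1 1 := by
    intro π hπ
    refine mem_preElevations.2 ⟨fun r hr => ?_, (isElevation_iff_elevates hn π σ).1 hπ⟩
    by_cases h1 : r = 1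
    · rw [h1, hone, hone]
    · rw [pntExt_of_not π (by omega), pntExt_of_not σ (by omega)]
  rw [← Nat.card_eq_finsetCard]
  refine Nat.card_congr (Equiv.ofBijective
    (fun π => ⟨pntExt π.1, hmem π.1 π.2.2⟩) ⟨fun π τ h => ?_, fun ⟨v, hv⟩ => ?_⟩)
  · exact Subtype.ext (pntExt_injective (congrArg Subtype.val h))
  · obtain ⟨hout, hel⟩ := mem_preElevations.1 hv
    have hbd := hel.bounds
      (fun r h1 h2 => pntExt_bounds σ (by omega) (by omega)) le_rfl
    have hv1 : v 1 = 1 := by rw [hout 1 (by omega), hone]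
    obtain ⟨π, hπ⟩ := exists_pnt_eq (fun j : Fin n => v (j + 1)) fun j => by
      rcases Nat.eq_zero_or_pos (j : ℕ) with h | h
      · simp [h, hv1]
      · exact hbd (j + 1) (by omega) (by omega)
    have hπv : pntExt π = v := by
      funext r
      by_cases hr : 1 ≤ r ∧ r ≤ n
      · obtain ⟨s, rfl⟩ := Nat.exists_eq_add_of_le' hr.1
        rw [pntExt_succ π ⟨s, hr.2⟩, hπ]
      · rw [pntExt_of_not π hr, hout r (by omega), pntExt_of_not σ hr]
    have hE : IsElevation π σ := (isElevation_iff_elevates hn π σ).2 (hπv ▸ hel)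
    exact ⟨⟨π, connectedPerm_of_kernelEnd ((isElevation_iff_kernelEnd hn π σ).1 hE).1, hE⟩,
      Subtype.ext hπv⟩

end Elevation


/-- If `σ(1) = 1`, `σ(n) = n` and the strong fixed points of `σ` (one-indexed)
are exactly `1 = d₀ < d₁ < ⋯ < d_{k+1} = n`, then the number of connected
permutations `π` with elevation `E(π) = σ` is `(d₁+1)(d₂+1)⋯(d_k+1)`. -/
theorem card_elevation_fiber (n k : ℕ) (hn : 2 ≤ n) (σ : Equiv.Perm (Fin n))
    (h1 : σ ⟨0, by omega⟩ = ⟨0, by omega⟩)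
    (h2 : σ ⟨n - 1, by omega⟩ = ⟨n - 1, by omega⟩)
    (d : Fin (k + 2) → ℕ) (hd : StrictMono d) (hd0 : d 0 = 1)
    (hdl : d (Fin.last (k + 1)) = n)
    (hsfp : ∀ m : ℕ, (∃ t, d t = m) ↔
      (1 ≤ m ∧ m ≤ n ∧
        ∀ i : Fin n, ((i : ℕ) + 1 = m → σ i = i) ∧ ((i : ℕ) < m → (σ i : ℕ) < m))) :
    Nat.card {π : Equiv.Perm (Fin n) // ConnectedPerm π ∧ IsElevation π σ} =
      ∏ t : Fin k, (d t.castSucc.succ + 1) := by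
  have hstrong : ∀ m, (∃ t, d t = m) ↔ 1 ≤ m ∧ m ≤ n ∧ StrongIndex (pntExt σ) n m := by
    intro m
    rw [hsfp]
    exact and_congr_right fun h1 => and_congr_right fun h2 => (strongIndex_pntExt_iff σ h1 h2).symm
  have hone := ((hstrong 1).1 ⟨0, hd0⟩).2.2
  have hlast := ((hstrong n).1 ⟨_, hdl⟩).2.2
  obtain ⟨q, rfl⟩ := Nat.exists_eq_add_of_le' hn
  rw [card_fiber_eq_card_preElevations hn, show q + 2 - 1 = q + 1 by omega,
    card_preElevations hlast.1 le_rfl (by omega), if_pos hone.2, one_mul]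
  symm
  refine Finset.prod_bij (fun t _ => d t.castSucc.succ) (fun t _ => ?_)
    (fun t _ t' _ h => ?_) (fun m hm => ?_) fun t _ => rfl
  · have h1 := hd (Fin.succ_pos t.castSucc)
    have h2 := hd (show t.castSucc.succ < Fin.last (k + 1) from
      Fin.succ_lt_succ_iff.2 (Fin.castSucc_lt_last t))
    have h3 := ((hstrong _).1 ⟨t.castSucc.succ, rfl⟩).2.2
    simp only [Finset.mem_filter, Finset.mem_Ioo]
    exact ⟨⟨by omega, by omega⟩, h3⟩
  · simpa using hd.injective h
  · simp only [Finset.mem_filter, Finset.mem_Ioo] at hm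
    obtain ⟨t, rfl⟩ := (hstrong m).2 ⟨by omega, by omega, hm.2⟩
    obtain rfl | ⟨t, rfl⟩ := t.eq_zero_or_eq_succ
    · omega
    · obtain ⟨t, rfl⟩ | rfl := t.eq_castSucc_or_eq_last
      · exact ⟨t, Finset.mem_univ t, rfl⟩
      · rw [Fin.succ_last] at hm
        exact absurd hdl hm.1.2.ne
end

section
/- Let v_1⋯v_n be the place-based non-inversion table of a permutation π of {1,…,n}. Then: (a) for all i < j, π(i) < π(j) implies v_i < v_j; and (b) if i < j and v_i < v_k for all k ∈ {i+1, …, j}, then π(i) < π(k) for all k ∈ {i+1, …, j}. -/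
/-- An ascent pair `π i < π j`, `i < j`, is reflected in the table. -/
theorem pnt_lt_pnt {n : ℕ} (π : Equiv.Perm (Fin n)) {i j : Fin n} (hij : i < j)
    (hπ : π i < π j) : pnt π i < pnt π j := by
  refine Nat.add_lt_add_left (Finset.card_lt_card ?_) 1
  rw [Finset.ssubset_iff_of_subset]
  · exact ⟨i, by simp [hij, hπ], by simp⟩
  · intro m hm
    simp only [Finset.mem_filter, Finset.mem_univ, true_and] at hm ⊢
    exact ⟨hm.1.trans hij, hm.2.trans hπ⟩

/-- If `π k < π i` and `π i` is below all values strictly between positions `i` and `k`, then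
the entry at `k` does not exceed the entry at `i`. -/
theorem pnt_le_pnt {n : ℕ} (π : Equiv.Perm (Fin n)) {i k : Fin n} (hπ : π k < π i)
    (hbetween : ∀ m, i < m → m < k → π i < π m) : pnt π k ≤ pnt π i := by
  refine Nat.add_le_add_left (Finset.card_le_card fun m hm => ?_) 1
  simp only [Finset.mem_filter, Finset.mem_univ, true_and] at hm ⊢
  have hmi : π m < π i := hm.2.trans hπ
  refine ⟨?_, hmi⟩
  rcases lt_trichotomy m i with h | rfl | h
  · exact h
  · exact absurd hmi (lt_irrefl _)
  · exact absurd hmi (hbetween m h hm.1).asymm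

/-- (a) `π(i) < π(j)` implies `v_i < v_j` for `i < j`; (b) conversely, if
`v_i < v_k` for all `k ∈ {i+1,…,j}`, then `π(i) < π(k)` for all such `k`. -/
theorem pnt_lt_iff (n : ℕ) (π : Equiv.Perm (Fin n)) :
    (∀ i j : Fin n, i < j → π i < π j → pnt π i < pnt π j) ∧
    (∀ i j : Fin n, i < j →
      (∀ k : Fin n, i < k → k ≤ j → pnt π i < pnt π k) →
      ∀ k : Fin n, i < k → k ≤ j → π i < π k) := by
  refine ⟨fun i j hij hπ => pnt_lt_pnt π hij hπ, fun i j _ hv k => ?_⟩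
  induction k using WellFoundedLT.induction with
  | ind k ih =>
    intro hik hkj
    by_contra! hle
    have hlt : π k < π i := lt_of_le_of_ne hle (π.injective.ne hik.ne')
    exact (pnt_le_pnt π hlt fun m him hmk => ih m hmk him (hmk.le.trans hkj)).not_gt
      (hv k hik hkj)
end
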